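/- arXiv:1210.7858 — 4 statements merged into one kernel-verified Lean document; each statement's English description precedes it below -/
import Mathlib

section
/- Let S = {v_1, ..., v_n} be a finite set of points in ℝ^m (n ≥ 1) and let p ∈ ℝ^m. Then p lies in the convex hull of S if and only if for every point p' in the convex hull of S there exists an index j ∈ {1, ..., n} such that ‖p' − v_j‖ ≥ ‖p − v_j‖, where ‖·‖ denotes the Euclidean norm. -/
section InnerProductSpace

variable {E : Type*} [NormedAddCommGroup E] [InnerProductSpace ℝ E]

/-- The set of points strictly closer to `q` than to `p` is an open half-space. -/
theorem norm_sub_lt_norm_sub_iff_inner (p q x : E) :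
    ‖q - x‖ < ‖p - x‖ ↔ inner ℝ (p - q) x < (‖p‖ ^ 2 - ‖q‖ ^ 2) / 2 := by
  rw [← sq_lt_sq₀ (norm_nonneg _) (norm_nonneg _), norm_sub_sq_real, norm_sub_sq_real,
    inner_sub_left]
  constructor <;> intro h <;> linarith

theorem convex_setOf_norm_sub_lt_norm_sub (p q : E) :
    Convex ℝ {x | ‖q - x‖ < ‖p - x‖} := by
  simp only [norm_sub_lt_norm_sub_iff_inner]
  exact convex_halfSpace_lt (innerₛₗ ℝ (p - q)).isLinear _

theorem exists_norm_sub_le_of_mem_convexHull {s : Set E} {p : E} (hp : p ∈ convexHull ℝ s)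
    (q : E) : ∃ x ∈ s, ‖p - x‖ ≤ ‖q - x‖ := by
  by_contra! h
  have hlt : ‖q - p‖ < ‖p - p‖ :=
    convexHull_min h (convex_setOf_norm_sub_lt_norm_sub p q) hp
  rw [sub_self, norm_zero] at hlt
  exact (norm_nonneg _).not_gt hlt

/-- A point outside a nonempty complete convex set is strictly farther from every point of the
set than its projection is. -/
theorem exists_mem_forall_norm_sub_lt {K : Set E} (hne : K.Nonempty) (hK : IsComplete K)
    (hconv : Convex ℝ K) {p : E} (hp : p ∉ K) :
    ∃ q ∈ K, ∀ x ∈ K, ‖q - x‖ < ‖p - x‖ := by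
  obtain ⟨q, hq, hmin⟩ := exists_norm_eq_iInf_of_complete_convex hne hK hconv p
  refine ⟨q, hq, fun x hx => ?_⟩
  have hinner := (norm_eq_iInf_iff_real_inner_le_zero hconv hq).1 hmin x hx
  have hpos : 0 < ‖p - q‖ := norm_sub_pos_iff.2 (ne_of_mem_of_not_mem hq hp).symm
  have hexp := norm_sub_sq_real (p - q) (x - q)
  rw [sub_sub_sub_cancel_right] at hexp
  rw [← sq_lt_sq₀ (norm_nonneg _) (norm_nonneg _), hexp, norm_sub_rev q x]
  nlinarith [pow_pos hpos 2]

end InnerProductSpace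

/-- Distance Duality, part (i): `p` lies in the convex hull of `S = {v 1, ..., v n}` iff
for every `p'` in the convex hull there is an index `j` with `‖p' - v j‖ ≥ ‖p - v j‖`. -/
theorem distance_duality_mem (m n : ℕ) (hn : 1 ≤ n)
    (v : Fin n → EuclideanSpace ℝ (Fin m)) (p : EuclideanSpace ℝ (Fin m)) :
    p ∈ convexHull ℝ (Set.range v) ↔
      ∀ p' ∈ convexHull ℝ (Set.range v), ∃ j : Fin n, ‖p' - v j‖ ≥ ‖p - v j‖ := by
  constructor
  · intro hp p' _
    obtain ⟨_, ⟨j, rfl⟩, hj⟩ := exists_norm_sub_le_of_mem_convexHull hp p'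
    exact ⟨j, hj⟩
  · intro h
    by_contra hp
    have hne : (convexHull ℝ (Set.range v)).Nonempty :=
      ⟨v ⟨0, hn⟩, subset_convexHull ℝ _ (Set.mem_range_self _)⟩
    obtain ⟨q, hq, hlt⟩ := exists_mem_forall_norm_sub_lt hne
      ((Set.finite_range v).isCompact_convexHull (𝕜 := ℝ)).isComplete (convex_convexHull ℝ _) hp
    obtain ⟨j, hj⟩ := h q hq
    exact (hlt (v j) (subset_convexHull ℝ _ (Set.mem_range_self j))).not_ge hj
end

section
/- Let S = {v_1, ..., v_n} ⊂ ℝ^m (n ≥ 1) and p ∈ ℝ^m with p not in the convex hull of S. Let Δ = min{‖p − x‖ : x ∈ conv(S)} be the distance from p to conv(S). Then any witness p' ∈ conv(S) estimates Δ to within a factor of two: (1/2)‖p − p'‖ ≤ Δ ≤ ‖p − p'‖. -/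
/-- The points at least as close to `b` as to `a` form a closed half-space, hence a convex set. -/
theorem convex_setOf_norm_sub_le_norm_sub {E : Type*} [NormedAddCommGroup E]
    [InnerProductSpace ℝ E] (a b : E) : Convex ℝ {x : E | ‖b - x‖ ≤ ‖a - x‖} := by
  have h : {x : E | ‖b - x‖ ≤ ‖a - x‖} =
      {x : E | innerₗ E (a - b) x ≤ (‖a‖ ^ 2 - ‖b‖ ^ 2) / 2} := by
    ext x
    simp only [Set.mem_ofPred_eq, innerₗ_apply_apply, inner_sub_left]
    rw [← sq_le_sq₀ (norm_nonneg _) (norm_nonneg _), norm_sub_sq_real, norm_sub_sq_real]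
    constructor <;> intro h <;> linarith
  rw [h]
  exact convex_halfSpace_le (innerₗ E (a - b)).isLinear _

/-- A witness `p'` estimates the distance `Δ` from `p` to the convex hull to within a
factor of two: `(1/2)‖p - p'‖ ≤ Δ ≤ ‖p - p'‖`. -/
theorem witness_estimates_distance (m n : ℕ) (hn : 1 ≤ n)
    (v : Fin n → EuclideanSpace ℝ (Fin m)) (p : EuclideanSpace ℝ (Fin m))
    (hp : p ∉ convexHull ℝ (Set.range v))
    (Δ : ℝ) (hΔ : IsLeast {r : ℝ | ∃ x ∈ convexHull ℝ (Set.range v), r = ‖p - x‖} Δ)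
    (p' : EuclideanSpace ℝ (Fin m)) (hp' : p' ∈ convexHull ℝ (Set.range v))
    (hw : ∀ i : Fin n, ‖p' - v i‖ < ‖p - v i‖) :
    (1 / 2) * ‖p - p'‖ ≤ Δ ∧ Δ ≤ ‖p - p'‖ := by
  obtain ⟨⟨x, hx, rfl⟩, hmin⟩ := hΔ
  have hcloser : ‖p' - x‖ ≤ ‖p - x‖ :=
    convexHull_min (Set.range_subset_iff.2 fun i => (hw i).le)
      (convex_setOf_norm_sub_le_norm_sub p p') hx
  have htri : ‖p - p'‖ ≤ ‖p - x‖ + ‖x - p'‖ := norm_sub_le_norm_sub_add_norm_sub p x p'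
  rw [norm_sub_rev x p'] at htri
  exact ⟨by linarith, hmin ⟨p', hp', rfl⟩⟩
end

section
/- (Sensitivity Theorem) Let A be an n × n real matrix with columns a_1, ..., a_n ∈ ℝ^n, and b ∈ ℝ^n. Let Δ_0 = min{‖p‖ : p ∈ conv({a_1, ..., a_n})} and ρ = max{‖a_1‖, ..., ‖a_n‖, ‖b‖}. Let Δ_0' be any number with 0 < Δ_0' ≤ Δ_0, and suppose ε ∈ (0,1) satisfies ε ≤ Δ_0'/(2ρ). Suppose α_1, ..., α_{n+1} are nonnegative reals with α_1 + ... + α_{n+1} = 1 such that the point p' = α_1 a_1 + ... + α_n a_n − α_{n+1} b satisfies ‖p'‖ ≤ ε ρ. Then α_{n+1} > 0, and the vector x_0 = (α_1/α_{n+1}, ..., α_n/α_{n+1})^T satisfies x_0 ≥ 0 and ‖A x_0 − b‖ ≤ ε' ρ, where ε' = 2(1 + ‖b‖/Δ_0') ε. -/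
/-- If every point of the convex hull of a family has norm at least `d`, then a nonnegative
combination of the family has norm at least `d` times its total weight. -/
theorem sum_mul_le_norm_sum_smul {ι E : Type*} [Fintype ι] [NormedAddCommGroup E]
    [NormedSpace ℝ E] {a : ι → E} {d : ℝ} (hd : ∀ q ∈ convexHull ℝ (Set.range a), d ≤ ‖q‖)
    {w : ι → ℝ} (hw : ∀ i, 0 ≤ w i) : (∑ i, w i) * d ≤ ‖∑ i, w i • a i‖ := by
  rcases (Finset.sum_nonneg fun i _ => hw i).eq_or_lt with h | h
  · rw [← h, zero_mul]
    exact norm_nonneg _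
  · have hmem := Finset.centerMass_mem_convexHull Finset.univ (fun i _ => hw i) h
      (fun i _ => Set.mem_range_self (f := a) i)
    have hle := hd _ hmem
    rw [Finset.centerMass, norm_smul, norm_inv, Real.norm_of_nonneg h.le] at hle
    rwa [← le_inv_mul_iff₀ h]

/-- Sensitivity Theorem: if `p' = Σ αᵢ aᵢ - α_{n+1} b` is a point of
`conv{a₁, ..., aₙ, -b}` with `‖p'‖ ≤ ε ρ`, where `ε ≤ Δ₀'/(2ρ)` and `0 < Δ₀' ≤ Δ₀`,
then `α_{n+1} > 0` and `x₀ = (α₁/α_{n+1}, ..., αₙ/α_{n+1})` is a nonnegative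
`ε'`-approximate solution of `Ax = b`, with `ε' = 2(1 + ‖b‖/Δ₀')ε`. -/
theorem sensitivity_theorem (n : ℕ) (A : Matrix (Fin n) (Fin n) ℝ)
    (b : EuclideanSpace ℝ (Fin n))
    (a : Fin n → EuclideanSpace ℝ (Fin n))
    (ha : ∀ i, a i = (EuclideanSpace.equiv (Fin n) ℝ).symm (fun j => A j i))
    (Δ₀ ρ : ℝ)
    (hΔ₀ : IsLeast {r : ℝ | ∃ q ∈ convexHull ℝ (Set.range a), r = ‖q‖} Δ₀)
    (hρ : IsGreatest ({r : ℝ | ∃ i : Fin n, r = ‖a i‖} ∪ {‖b‖}) ρ)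
    (Δ₀' : ℝ) (hΔ'pos : 0 < Δ₀') (hΔ'le : Δ₀' ≤ Δ₀)
    (ε : ℝ) (hε0 : 0 < ε) (hε1 : ε < 1) (hεle : ε ≤ Δ₀' / (2 * ρ))
    (α : Fin (n + 1) → ℝ) (hαnn : ∀ i, 0 ≤ α i) (hαsum : ∑ i, α i = 1)
    (p' : EuclideanSpace ℝ (Fin n))
    (hp' : p' = (∑ i : Fin n, α i.castSucc • a i) - α (Fin.last n) • b)
    (hp'norm : ‖p'‖ ≤ ε * ρ) :
    0 < α (Fin.last n) ∧
    (∀ i : Fin n, 0 ≤ α i.castSucc / α (Fin.last n)) ∧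
    ‖(EuclideanSpace.equiv (Fin n) ℝ).symm
        (A.mulVec fun i => α i.castSucc / α (Fin.last n)) - b‖ ≤
      (2 * (1 + ‖b‖ / Δ₀') * ε) * ρ := by
  obtain ⟨t, ht⟩ : ∃ t, t = α (Fin.last n) := ⟨_, rfl⟩
  have ht0 : 0 ≤ t := ht ▸ hαnn _
  rw [Fin.sum_univ_castSucc, ← ht] at hαsum
  rw [← ht] at hp' ⊢
  have hρ0 : 0 < ρ := by
    have hb : ‖b‖ ≤ ρ := hρ.2 (Or.inr rfl)
    refine ((norm_nonneg b).trans hb).lt_of_ne fun h => ?_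
    rw [← h, mul_zero, div_zero] at hεle
    exact hεle.not_gt hε0
  have hερ : ε * (2 * ρ) ≤ Δ₀' := (le_div_iff₀ (by positivity)).1 hεle
  have hlow := sum_mul_le_norm_sum_smul (a := a) (d := Δ₀')
    (fun q hq => hΔ'le.trans (hΔ₀.2 ⟨q, hq, rfl⟩)) (fun i => hαnn (Fin.castSucc i))
  have hup : ‖∑ i : Fin n, α i.castSucc • a i‖ ≤ ‖p'‖ + t * ‖b‖ := by
    have h : ∑ i : Fin n, α i.castSucc • a i = p' + t • b := by rw [hp', sub_add_cancel]
    rw [h, ← Real.norm_of_nonneg ht0, ← norm_smul, Real.norm_of_nonneg ht0]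
    exact norm_add_le _ _
  rw [eq_sub_of_add_eq hαsum] at hlow
  have hkey : Δ₀' ≤ 2 * t * (Δ₀' + ‖b‖) := by linarith
  have htpos : 0 < t := by
    refine ht0.lt_of_ne fun h => ?_
    rw [← h, mul_zero, zero_mul] at hkey
    exact hkey.not_gt hΔ'pos
  refine ⟨htpos, fun i => div_nonneg (hαnn _) ht0, ?_⟩
  have hx : (EuclideanSpace.equiv (Fin n) ℝ).symm (A.mulVec fun i => α i.castSucc / t) - b
      = t⁻¹ • p' := by
    rw [hp', smul_sub, inv_smul_smul₀ htpos.ne', Finset.smul_sum]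
    congr 1
    ext j
    simp only [ha, Matrix.mulVec, dotProduct, PiLp.continuousLinearEquiv_symm_apply,
      WithLp.ofLp_sum, WithLp.ofLp_smul, Finset.sum_apply, Pi.smul_apply, smul_eq_mul]
    exact Finset.sum_congr rfl fun i _ => by ring
  have hinv : t⁻¹ ≤ 2 * (1 + ‖b‖ / Δ₀') := by
    rw [inv_le_iff_one_le_mul₀ htpos, one_add_div hΔ'pos.ne', ← mul_div_assoc, div_mul_eq_mul_div,
      one_le_div hΔ'pos]
    linarith
  rw [hx, norm_smul, norm_inv, Real.norm_of_nonneg ht0, mul_assoc _ ε ρ]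
  gcongr
end

section
/- Let A be an invertible n × n real matrix, b ∈ ℝ^n, and x* = A^{-1} b with components x*_1, ..., x*_n. Let Q = A^T A with columns q_1, ..., q_n, let w = A^T b, and let q_min = min{‖q_j‖ : j = 1, ..., n}. Then for every i = 1, ..., n, x*_i ≥ − τ'_*, where τ'_* = (∏_{j=1}^n ‖q_j‖) ‖w‖ / (q_min · det(Q)). -/
/-- Hadamard's determinant inequality, for the columns of a real matrix. -/
theorem abs_det_le_prod_norm_col {n : ℕ} (M : Matrix (Fin n) (Fin n) ℝ) :
    |M.det| ≤ ∏ j, ‖WithLp.toLp 2 (M.col j)‖ := by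
  have : Fact (Module.finrank ℝ (EuclideanSpace ℝ (Fin n)) = n) := ⟨finrank_euclideanSpace_fin⟩
  let e := EuclideanSpace.basisFun (Fin n) ℝ
  have hvol := e.toBasis.orientation.volumeForm_robust e rfl
  have hle := e.toBasis.orientation.abs_volumeForm_apply_le fun j => WithLp.toLp 2 (M.col j)
  rw [hvol, Module.Basis.det_apply] at hle
  convert hle using 3
  ext k j
  simp [e, Module.Basis.toMatrix_apply]

/-- The components of a solution of `M x = w`, bounded by Cramer's rule and Hadamard's
inequality. -/
theorem abs_det_mul_le_of_mulVec_eq {n : ℕ} {M : Matrix (Fin n) (Fin n) ℝ} {x w : Fin n → ℝ}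
    (h : M.mulVec x = w) (i : Fin n) :
    |M.det * x i| ≤
      ‖WithLp.toLp 2 w‖ * ∏ j ∈ Finset.univ.erase i, ‖WithLp.toLp 2 (M.col j)‖ := by
  have hcramer : M.det * x i = (M.updateCol i w).det := by
    rw [← Matrix.cramer_apply, ← h, Matrix.cramer_eq_adjugate_mulVec, Matrix.mulVec_mulVec,
      Matrix.adjugate_mul, Matrix.smul_mulVec, Matrix.one_mulVec, Pi.smul_apply, smul_eq_mul]
  rw [hcramer]
  refine (abs_det_le_prod_norm_col _).trans_eq ?_
  rw [← Finset.mul_prod_erase _ _ (Finset.mem_univ i)]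
  congr 1
  · congr 2
    ext k
    simp
  · refine Finset.prod_congr rfl fun j hj => ?_
    congr 2
    ext k
    simp [Finset.ne_of_mem_erase hj]


/-- A priori lower bound on the components of `x* = A⁻¹b`: with `Q = AᵀA`, `w = Aᵀb`,
`q_min = min ‖q_j‖` over the columns `q_j` of `Q`, and
`τ'_* = (∏ ‖q_j‖) ‖w‖ / (q_min det Q)`, every component of `x*` is `≥ -τ'_*`. -/
theorem solution_component_lower_bound (n : ℕ) (A : Matrix (Fin n) (Fin n) ℝ)
    (hA : IsUnit A.det) (b : Fin n → ℝ)
    (xstar : Fin n → ℝ) (hx : A.mulVec xstar = b)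
    (Q : Matrix (Fin n) (Fin n) ℝ) (hQ : Q = A.transpose * A)
    (w : Fin n → ℝ) (hw : w = A.transpose.mulVec b)
    (nrm : (Fin n → ℝ) → ℝ)
    (hnrm : ∀ y : Fin n → ℝ, nrm y = ‖(EuclideanSpace.equiv (Fin n) ℝ).symm y‖)
    (qmin : ℝ) (hqmin : IsLeast (Set.range fun j : Fin n => nrm fun k => Q k j) qmin)
    (τ' : ℝ) (hτ' : τ' = (∏ j : Fin n, nrm fun k => Q k j) * nrm w / (qmin * Q.det)) :
    ∀ i : Fin n, xstar i ≥ -τ' := by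
  intro i
  have hnrm' : ∀ y : Fin n → ℝ, nrm y = ‖WithLp.toLp 2 y‖ := hnrm
  have hdet : 0 < Q.det := by
    rw [hQ, Matrix.det_mul, Matrix.det_transpose]
    exact mul_self_pos.2 hA.ne_zero
  have hQx : Q.mulVec xstar = w := by rw [hQ, hw, ← hx, Matrix.mulVec_mulVec]
  have hcol_pos : ∀ j, 0 < nrm fun k => Q k j := by
    intro j
    rw [hnrm', norm_pos_iff]
    intro h
    refine hdet.ne' (Matrix.det_eq_zero_of_column_eq_zero j fun k => ?_)
    exact congrFun (congrArg WithLp.ofLp h) k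
  have hqmin_pos : 0 < qmin := by
    obtain ⟨j, hj⟩ := hqmin.1
    exact hj ▸ hcol_pos j
  have hqmin_le : qmin ≤ nrm fun k => Q k i := hqmin.2 ⟨i, rfl⟩
  set P := ∏ j ∈ Finset.univ.erase i, nrm fun k => Q k j with hP
  have hP_nonneg : 0 ≤ P := Finset.prod_nonneg fun j _ => (hcol_pos j).le
  have hw_nonneg : 0 ≤ nrm w := by rw [hnrm']; exact norm_nonneg _
  have hbound : |Q.det * xstar i| ≤ nrm w * P := by
    simp only [hP, hnrm']
    exact abs_det_mul_le_of_mulVec_eq hQx i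
  have hle : -xstar i ≤ τ' := by
    rw [hτ', ← Finset.mul_prod_erase _ _ (Finset.mem_univ i), ← hP,
      le_div_iff₀ (mul_pos hqmin_pos hdet)]
    calc -xstar i * (qmin * Q.det) = qmin * -(Q.det * xstar i) := by ring
      _ ≤ qmin * (nrm w * P) := by gcongr; exact (neg_le_abs _).trans hbound
      _ ≤ (nrm fun k => Q k i) * (nrm w * P) := by gcongr
      _ = (nrm fun k => Q k i) * P * nrm w := by ring
  linarith
end
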